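/- arXiv:1207.3722 — 2 statements merged into one kernel-verified Lean document; each statement's English description precedes it below -/
import Mathlib

section
/- Suppose that for every AD-compact space K of weight at most 𝔠, the Banach space C(K) embeds isometrically into ℓ∞/c₀. Then 𝔠 is a Kunen cardinal, i.e., every subset of ℝ × ℝ belongs to the σ-field 𝒫²(ℝ). -/
open Filter Topology Set MeasureTheory

noncomputable section

/-- `ℓ∞`: the Banach space of bounded real sequences with the sup norm. -/
abbrev Linf : Type := lp (fun _ : ℕ => ℝ) ⊤

/-- `c₀`: the subspace of `ℓ∞` of sequences converging to `0`. -/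
def c0 : Submodule ℝ Linf where
  carrier := {x | Filter.Tendsto (fun n => (x : ∀ _ : ℕ, ℝ) n) Filter.atTop (nhds (0 : ℝ))}
  add_mem' := by
    intro a b ha hb
    simpa [lp.coeFn_add, Pi.add_apply] using ha.add hb
  zero_mem' := by
    simpa [lp.coeFn_zero] using
      (tendsto_const_nhds : Filter.Tendsto (fun _ : ℕ => (0 : ℝ)) Filter.atTop (nhds 0))
  smul_mem' := by
    intro c a ha
    simpa [lp.coeFn_smul, Pi.smul_apply, smul_eq_mul] using ha.const_mul c

/-- The quotient Banach space `ℓ∞/c₀` with the quotient norm. -/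
abbrev LinfQuot : Type := Linf ⧸ c0

/-- The σ-field `𝒫ⁿ(ℝ)` on `ℝⁿ` generated by products `A₁ × ⋯ × Aₙ` of arbitrary sets. -/
def prodSigma (n : ℕ) : MeasurableSpace (Fin n → ℝ) :=
  MeasurableSpace.generateFrom {S | ∃ A : Fin n → Set ℝ, S = Set.univ.pi A}

/-- The σ-field `𝒫²(ℝ)` on `ℝ × ℝ` generated by rectangles `A × B` with `A, B ⊆ ℝ` arbitrary. -/
def P2 : MeasurableSpace (ℝ × ℝ) :=
  MeasurableSpace.generateFrom {S | ∃ A B : Set ℝ, S = A ×ˢ B}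

/-- The weight of a topological space: the minimal cardinality of a base. -/
def tWeight (K : Type u) [TopologicalSpace K] : Cardinal.{u} :=
  sInf {c | ∃ B : Set (Set K), TopologicalSpace.IsTopologicalBasis B ∧ Cardinal.mk B = c}

/-- A family of subsets of `X` is adequate if it is closed under subsets and contains every
set all of whose finite subsets belong to the family. -/
def IsAdequate {X : Type u} (A : Set (Set X)) : Prop :=
  (∀ s ∈ A, ∀ t ⊆ s, t ∈ A) ∧
  (∀ s : Set X, (∀ t ⊆ s, t.Finite → t ∈ A) → s ∈ A)

/-- `K(𝒜)`: the set of characteristic functions of members of `𝒜`, in `{0,1}^X`. -/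
def KofFam {X : Type u} (A : Set (Set X)) : Set (X → Bool) :=
  {f | {x | f x = true} ∈ A}

/-- A compact space is AD-compact if it is a continuous image of an adequate compactum `K(𝒜)`. -/
def IsADCompact (K : Type u) [TopologicalSpace K] : Prop :=
  ∃ (X : Type u) (_ : Nonempty X) (A : Set (Set X)), IsAdequate A ∧
    ∃ g : ↥(KofFam A) → K, Continuous g ∧ Function.Surjective g

/-- The weight of `K(𝒜)` is at most `|X|`, with a base indexed by finite sets of coordinate
conditions. -/
lemma tWeight_KofFam_le {X : Type} [Infinite X] (A : Set (Set X)) :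
    tWeight ↥(KofFam A) ≤ Cardinal.mk X := by
  classical
  let U : Finset (X × Bool) → Set ↥(KofFam A) := fun F => {f | ∀ p ∈ F, f.1 p.1 = p.2}
  have hU : TopologicalSpace.IsTopologicalBasis (Set.range U) := by
    refine TopologicalSpace.isTopologicalBasis_of_isOpen_of_nhds ?_ ?_
    · rintro _ ⟨F, rfl⟩
      have hF : U F = ⋂ p ∈ F, (fun f : ↥(KofFam A) => f.1 p.1) ⁻¹' {p.2} := by
        ext f
        simp [U]
      rw [hF]
      exact isOpen_biInter_finset fun p _ => (isOpen_discrete _).preimage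
        ((continuous_apply p.1).comp continuous_subtype_val)
    · intro f V hf hV
      obtain ⟨W, hW, rfl⟩ := isOpen_induced_iff.1 hV
      obtain ⟨I, u, hu, hI⟩ := isOpen_pi_iff.1 hW f.1 hf
      refine ⟨U (I.image fun x => (x, f.1 x)), ⟨_, rfl⟩, ?_, ?_⟩
      · intro p hp
        obtain ⟨x, -, rfl⟩ := Finset.mem_image.1 hp
        rfl
      · intro g hg
        refine hI fun x hx => ?_
        have hgx : g.1 x = f.1 x := hg (x, f.1 x) (Finset.mem_image_of_mem _ hx)
        rw [hgx]
        exact (hu x hx).2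
  calc tWeight ↥(KofFam A) ≤ Cardinal.mk (Set.range U) := csInf_le' ⟨_, hU, rfl⟩
    _ ≤ Cardinal.mk (Finset (X × Bool)) := Cardinal.mk_range_le
    _ = Cardinal.mk X := by
      rw [Cardinal.mk_finset_of_infinite, Cardinal.mk_prod]
      simp only [Cardinal.lift_id]
      exact Cardinal.mul_eq_left (Cardinal.aleph0_le_mk X)
        ((Cardinal.lt_aleph0_of_finite Bool).le.trans (Cardinal.aleph0_le_mk X)) (by simp)

/-- The family of a relation `E`: sets in `ℝ ⊕ ℝ` all of whose cross pairs
belong to `E`. -/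
def crossFam (E : Set (ℝ × ℝ)) : Set (Set (ℝ ⊕ ℝ)) :=
  {s | ∀ a b, Sum.inl a ∈ s → Sum.inr b ∈ s → (a, b) ∈ E}

lemma isAdequate_crossFam (E : Set (ℝ × ℝ)) : IsAdequate (crossFam E) := by
  refine ⟨fun s hs t hts a b ha hb => hs a b (hts ha) (hts hb), fun s hs a b ha hb => ?_⟩
  refine hs {Sum.inl a, Sum.inr b} ?_ (Set.toFinite _) a b (by simp) (by simp)
  rintro x (rfl | rfl)
  exacts [ha, hb]

lemma isClosed_KofFam_crossFam (E : Set (ℝ × ℝ)) : IsClosed (KofFam (crossFam E)) := by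
  have hK : KofFam (crossFam E) = ⋂ (a : ℝ) (b : ℝ) (_ : (a, b) ∉ E),
      (fun f : ℝ ⊕ ℝ → Bool => (f (Sum.inl a), f (Sum.inr b))) ⁻¹' {(true, true)}ᶜ := by
    ext f
    simp only [KofFam, crossFam, Set.mem_ofPred_eq, Set.mem_iInter, Set.mem_preimage,
      Set.mem_compl_iff, Set.mem_singleton_iff, Prod.mk.injEq]
    exact forall₂_congr fun a b => by tauto
  rw [hK]
  exact isClosed_iInter fun a => isClosed_iInter fun b => isClosed_iInter fun _ =>
    (isClosed_discrete _).preimage ((continuous_apply _).prodMk (continuous_apply _))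

/-- The coordinate function of `K(𝒜)` at `x`, as a real-valued continuous function. -/
def coordFun {X : Type} (A : Set (Set X)) (x : X) : C(↥(KofFam A), ℝ) where
  toFun f := if f.1 x = true then 1 else 0
  continuous_toFun := (continuous_of_discreteTopology
    (f := fun b : Bool => if b = true then (1 : ℝ) else 0)).comp
      ((continuous_apply x).comp continuous_subtype_val)

lemma two_le_norm_coordFun_add {E : Set (ℝ × ℝ)} [CompactSpace ↥(KofFam (crossFam E))]
    {a b : ℝ} (hab : (a, b) ∈ E) :
    2 ≤ ‖coordFun (crossFam E) (Sum.inl a) + coordFun (crossFam E) (Sum.inr b)‖ := by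
  classical
  let f : ↥(KofFam (crossFam E)) :=
    ⟨fun x => decide (x = Sum.inl a ∨ x = Sum.inr b), by
      intro c d hc hd
      simp only [Set.mem_ofPred_eq, decide_eq_true_eq, Sum.inl.injEq, Sum.inr.injEq, reduceCtorEq,
        or_false, false_or] at hc hd
      rwa [hc, hd]⟩
  have hf := ContinuousMap.norm_coe_le_norm
    (coordFun (crossFam E) (Sum.inl a) + coordFun (crossFam E) (Sum.inr b)) f
  norm_num [coordFun, f] at hf
  exact hf

lemma norm_coordFun_add_le_one {E : Set (ℝ × ℝ)} [CompactSpace ↥(KofFam (crossFam E))]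
    {a b : ℝ} (hab : (a, b) ∉ E) :
    ‖coordFun (crossFam E) (Sum.inl a) + coordFun (crossFam E) (Sum.inr b)‖ ≤ 1 := by
  refine (ContinuousMap.norm_le _ zero_le_one).2 fun f => ?_
  have hf : ¬ (f.1 (Sum.inl a) = true ∧ f.1 (Sum.inr b) = true) :=
    fun h => hab (f.2 a b h.1 h.2)
  simp only [coordFun, ContinuousMap.add_apply, ContinuousMap.coe_mk]
  split_ifs <;> simp_all

lemma norm_mk_le_of_eventually {z : Linf} {r : ℝ} (hr : 0 ≤ r)
    (hz : ∀ᶠ n in atTop, |z n| ≤ r) : ‖(Submodule.Quotient.mk z : LinfQuot)‖ ≤ r := by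
  classical
  obtain ⟨N, hN⟩ := eventually_atTop.1 hz
  have hbound : ∀ n, ‖(if N ≤ n then z n else 0 : ℝ)‖ ≤ r := by
    intro n
    split_ifs with h
    · exact hN n h
    · simpa using hr
  let w : Linf := ⟨fun n => if N ≤ n then z n else 0,
    memℓp_infty ⟨r, by rintro _ ⟨n, rfl⟩; exact hbound n⟩⟩
  have hzw : (Submodule.Quotient.mk z : LinfQuot) = Submodule.Quotient.mk w := by
    refine (Submodule.Quotient.eq c0).2 ?_
    refine tendsto_const_nhds.congr' ?_
    filter_upwards [eventually_ge_atTop N] with n hn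
    change (0 : ℝ) = z n - (if N ≤ n then z n else 0)
    rw [if_pos hn, sub_self]
  rw [hzw]
  exact (Submodule.Quotient.norm_mk_le c0 w).trans (lp.norm_le_of_forall_le hr hbound)

lemma eventually_of_norm_mk_lt {z : Linf} {r : ℝ}
    (hz : ‖(Submodule.Quotient.mk z : LinfQuot)‖ < r) : ∀ᶠ n in atTop, |z n| ≤ r := by
  obtain ⟨w, hw, hwr⟩ := Submodule.Quotient.norm_mk_lt (Submodule.Quotient.mk z : LinfQuot)
    (sub_pos.2 hz)
  have hwr' : ‖w‖ < r := by linarith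
  have hmem : Tendsto (fun n => (w - z) n) atTop (𝓝 0) := (Submodule.Quotient.eq c0).1 hw
  filter_upwards [(Metric.tendsto_nhds.1 hmem) (r - ‖w‖) (sub_pos.2 hwr')] with n hn
  have hwn : |w n| ≤ ‖w‖ := lp.norm_apply_le_norm ENNReal.top_ne_zero w n
  have hn' : |w n - z n| < r - ‖w‖ := by simpa using hn
  have := abs_sub_abs_le_abs_sub (z n) (w n)
  rw [abs_sub_comm] at this
  linarith

lemma measurableSet_P2_frequently (f g : ℝ → ℕ → ℝ) (r : ℝ) :
    MeasurableSet[P2] {p : ℝ × ℝ | ∃ᶠ n in atTop, r < |f p.1 n + g p.2 n|} := by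
  let _ : MeasurableSpace (ℝ × ℝ) := P2
  have hfst : ∀ n, Measurable fun p : ℝ × ℝ => f p.1 n := fun n S _ =>
    MeasurableSpace.measurableSet_generateFrom ⟨{a | f a n ∈ S}, Set.univ, by ext; simp⟩
  have hsnd : ∀ n, Measurable fun p : ℝ × ℝ => g p.2 n := fun n S _ =>
    MeasurableSpace.measurableSet_generateFrom ⟨Set.univ, {b | g b n ∈ S}, by ext; simp⟩
  simp only [frequently_atTop, Set.ofPred_forall, Set.ofPred_exists, Set.ofPred_and]
  refine MeasurableSet.iInter fun N => MeasurableSet.iUnion fun n =>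
    (MeasurableSet.const _).inter ?_
  exact measurableSet_lt measurable_const ((hfst n).add (hsnd n)).norm

/-- If for every AD-compact space of weight at most `𝔠` the space `C(K)` embeds isometrically
into `ℓ∞/c₀`, then `𝔠` is a Kunen cardinal: every subset of `ℝ × ℝ` belongs to `𝒫²(ℝ)`. -/
theorem stmt_11
    (h : ∀ (K : Type) [TopologicalSpace K] [CompactSpace K],
      IsADCompact K → tWeight K ≤ Cardinal.continuum →
      Nonempty (C(K, ℝ) →ₗᵢ[ℝ] LinfQuot)) :
    ∀ E : Set (ℝ × ℝ), MeasurableSet[P2] E := by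
  intro E
  have : CompactSpace ↥(KofFam (crossFam E)) :=
    isCompact_iff_compactSpace.1 (isClosed_KofFam_crossFam E).isCompact
  have hweight : tWeight ↥(KofFam (crossFam E)) ≤ Cardinal.continuum := by
    refine (tWeight_KofFam_le _).trans ?_
    simp [Cardinal.mk_real]
  obtain ⟨T⟩ := h ↥(KofFam (crossFam E))
    ⟨ℝ ⊕ ℝ, inferInstance, crossFam E, isAdequate_crossFam E, id, continuous_id,
      Function.surjective_id⟩ hweight
  choose l hl using fun x : ℝ ⊕ ℝ => Submodule.Quotient.mk_surjective c0
    (T (coordFun (crossFam E) x))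
  have hnorm : ∀ a b, ‖(Submodule.Quotient.mk (l (Sum.inl a) + l (Sum.inr b)) : LinfQuot)‖ =
      ‖coordFun (crossFam E) (Sum.inl a) + coordFun (crossFam E) (Sum.inr b)‖ := by
    intro a b
    rw [Submodule.Quotient.mk_add, hl, hl, ← map_add, T.norm_map]
  have hE : E = {p : ℝ × ℝ |
      ∃ᶠ n in atTop, (3 / 2 : ℝ) < |l (Sum.inl p.1) n + l (Sum.inr p.2) n|} := by
    ext ⟨a, b⟩
    refine ⟨fun hab => ?_, fun hfr => ?_⟩
    · by_contra hfr
      have hev : ∀ᶠ n in atTop, |(l (Sum.inl a) + l (Sum.inr b)) n| ≤ (3 / 2 : ℝ) := by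
        simpa [not_frequently] using hfr
      have := norm_mk_le_of_eventually (by norm_num) hev
      rw [hnorm] at this
      linarith [two_le_norm_coordFun_add hab]
    · by_contra hab
      have hlt : ‖(Submodule.Quotient.mk (l (Sum.inl a) + l (Sum.inr b)) : LinfQuot)‖ <
          (3 / 2 : ℝ) := by
        rw [hnorm]
        linarith [norm_coordFun_add_le_one hab]
      refine hfr ((eventually_of_norm_mk_lt hlt).mono fun n hn => not_lt.2 ?_)
      simpa using hn
  rw [hE]
  exact measurableSet_P2_frequently (fun a => l (Sum.inl a)) (fun b => l (Sum.inr b)) _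
end
end

section
/- For every integer n ≥ 2, the set {(x₁,…,xₙ) ∈ ℝⁿ : x₁ < x₂ < … < xₙ} of strictly increasing n-tuples belongs to the σ-field 𝒫ⁿ(ℝ); in particular {(x,y) ∈ ℝ² : x < y} belongs to 𝒫²(ℝ). -/
open Filter Topology Set MeasureTheory

noncomputable section

theorem measurableSet_lt_of_preimage {α : Type*} [MeasurableSpace α] {f g : α → ℝ}
    (hf : ∀ A : Set ℝ, MeasurableSet (f ⁻¹' A)) (hg : ∀ A : Set ℝ, MeasurableSet (g ⁻¹' A)) :
    MeasurableSet {x | f x < g x} :=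
  measurableSet_lt (fun A _ => hf A) (fun A _ => hg A)

theorem measurableSet_prodSigma_eval_preimage {n : ℕ} (i : Fin n) (A : Set ℝ) :
    MeasurableSet[prodSigma n] ((Function.eval i : (Fin n → ℝ) → ℝ) ⁻¹' A) :=
  MeasurableSpace.measurableSet_generateFrom
    ⟨Function.update (fun _ => Set.univ) i A, (Set.univ_pi_update_univ (α := fun _ => ℝ) i A).symm⟩

theorem measurableSet_P2_fst_preimage (A : Set ℝ) :
    MeasurableSet[P2] ((Prod.fst : ℝ × ℝ → ℝ) ⁻¹' A) :=
  MeasurableSpace.measurableSet_generateFrom ⟨A, Set.univ, Set.prod_univ.symm⟩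

theorem measurableSet_P2_snd_preimage (A : Set ℝ) :
    MeasurableSet[P2] ((Prod.snd : ℝ × ℝ → ℝ) ⁻¹' A) :=
  MeasurableSpace.measurableSet_generateFrom ⟨Set.univ, A, Set.univ_prod.symm⟩

/-- For every `n ≥ 2`, the set of strictly increasing `n`-tuples of reals belongs to `𝒫ⁿ(ℝ)`;
in particular `{(x,y) : x < y}` belongs to `𝒫²(ℝ)`. -/
theorem stmt_17 (n : ℕ) (hn : 2 ≤ n) :
    MeasurableSet[prodSigma n] {x : Fin n → ℝ | ∀ i j : Fin n, i < j → x i < x j} ∧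
    MeasurableSet[P2] {p : ℝ × ℝ | p.1 < p.2} := by
  refine ⟨?_, @measurableSet_lt_of_preimage _ P2 _ _ measurableSet_P2_fst_preimage
    measurableSet_P2_snd_preimage⟩
  let _ : MeasurableSpace (Fin n → ℝ) := prodSigma n
  simp only [Set.ofPred_forall]
  exact MeasurableSet.iInter fun i => MeasurableSet.iInter fun j => MeasurableSet.iInter fun _ =>
    @measurableSet_lt_of_preimage _ (prodSigma n) _ _ (measurableSet_prodSigma_eval_preimage i)
      (measurableSet_prodSigma_eval_preimage j)
end
end
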